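/- For q > 0 and all x ≥ b, ∫_b^x 𝕎(x−y) ( e^{Φ(q)y} + αΦ(q)∫_b^y e^{Φ(q)z} 𝕎^{(q)}(y−z) dz ) dy = (1 − αΦ(q)/q) ∫_b^x e^{Φ(q)y} 𝕎(x−y) dy + (αΦ(q)/q) ∫_b^x e^{Φ(q)y} 𝕎^{(q)}(x−y) dy. -/

import Mathlib

open MeasureTheory Set Filter Topology

/-- The Laplace exponent of a spectrally negative Lévy process with triplet `(γ, σ, ν)`. -/
noncomputable def levyPsi (γ σ : ℝ) (ν : Measure ℝ) (l : ℝ) : ℝ :=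
  γ * l + σ ^ 2 / 2 * l ^ 2 +
    ∫ z in Set.Ioi (0 : ℝ),
      (Real.exp (-l * z) - 1 +
        l * z * Set.indicator (Set.Ioc (0 : ℝ) 1) (fun _ => (1 : ℝ)) z) ∂ν

/-- The right-inverse `Φ(q) = sup {λ ≥ 0 : f(λ) = q}` of a Laplace exponent `f`. -/
noncomputable def levyPhi (f : ℝ → ℝ) (q : ℝ) : ℝ :=
  sSup {l : ℝ | 0 ≤ l ∧ f l = q}

/-- `∫₀¹ z ν(dz)`, as an extended nonnegative real. -/
noncomputable def smallJumpMass (ν : Measure ℝ) : ENNReal :=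
  ∫⁻ z in Set.Ioc (0 : ℝ) 1, ENNReal.ofReal z ∂ν

/-- `ν` is a Lévy measure on `(0,∞)`: it charges only `(0,∞)` and
integrates `min(1, z²)`. -/
def IsLevyMeasure (ν : Measure ℝ) : Prop :=
  ν (Set.Iic 0) = 0 ∧ (∫⁻ z in Set.Ioi (0 : ℝ), ENNReal.ofReal (min 1 (z ^ 2)) ∂ν) ≠ ⊤

/-- The process is not the negative of a subordinator: `σ > 0`, or
`∫₀¹ z ν(dz) = ∞`, or `γ + ∫₀¹ z ν(dz) > 0`. -/
def NonDegenerate (γ σ : ℝ) (ν : Measure ℝ) : Prop :=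
  0 < σ ∨ smallJumpMass ν = ⊤ ∨ 0 < γ + (smallJumpMass ν).toReal

/-- `W` is the `q`-scale function associated with the Laplace exponent `f`,
where `Φq` is the value of the right-inverse of `f` at `q`. -/
def IsScaleFunction (f : ℝ → ℝ) (Φq q : ℝ) (W : ℝ → ℝ) : Prop :=
  (∀ x < 0, W x = 0) ∧ ContinuousOn W (Set.Ici 0) ∧ MonotoneOn W (Set.Ici 0) ∧
    ∀ l, Φq < l → (∫ y in Set.Ioi (0 : ℝ), Real.exp (-l * y) * W y) = 1 / (f l - q)

/-- Admissibility of the refraction parameter `α`: `α > 0`, and when the paths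
have bounded variation (`σ = 0` and `∫₀¹ z ν(dz) < ∞`), `α` is smaller than the
drift `c = γ + ∫₀¹ z ν(dz)`. -/
def AlphaAdmissible (γ σ α : ℝ) (ν : Measure ℝ) : Prop :=
  0 < α ∧ ((σ = 0 ∧ smallJumpMass ν ≠ ⊤) → α < γ + (smallJumpMass ν).toReal)

lemma abs_levyIntegrand_le {l z : ℝ} (hl : 0 ≤ l) (hz : 0 < z) :
    |Real.exp (-l * z) - 1 + l * z * indicator (Ioc (0 : ℝ) 1) (fun _ => (1 : ℝ)) z| ≤
      (1 + l ^ 2) * min 1 (z ^ 2) := by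
  have hlz : 0 ≤ l * z := by positivity
  have h0 : 0 < Real.exp (-l * z) := Real.exp_pos _
  rcases le_or_gt z 1 with h1 | h1
  · rw [indicator_of_mem (show z ∈ Ioc (0 : ℝ) 1 from ⟨hz, h1⟩), min_eq_right (by nlinarith)]
    have h2 : 1 - l * z ≤ Real.exp (-l * z) := by
      have := Real.add_one_le_exp (-l * z); linarith
    have h3 : Real.exp (-l * z) * (1 + l * z) ≤ 1 := by
      have h4 := Real.add_one_le_exp (l * z)
      have h5 : Real.exp (-l * z) * Real.exp (l * z) = 1 := by
        rw [← Real.exp_add]; simp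
      nlinarith
    have h6 : Real.exp (-l * z) ≤ 1 - l * z + (l * z) ^ 2 := by
      nlinarith [pow_nonneg hlz 3]
    rw [abs_of_nonneg (by linarith)]
    nlinarith [sq_nonneg z]
  · rw [indicator_of_notMem (fun h : z ∈ Ioc (0 : ℝ) 1 => absurd h.2 (not_le.2 h1)),
      min_eq_left (by nlinarith)]
    have h2 : Real.exp (-l * z) ≤ 1 := Real.exp_le_one_iff.2 (by linarith)
    rw [abs_le]
    constructor <;> nlinarith [sq_nonneg l]

lemma integrableOn_levyIntegrand {ν : Measure ℝ} (hν : IsLevyMeasure ν) {l : ℝ} (hl : 0 ≤ l) :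
    IntegrableOn (fun z => Real.exp (-l * z) - 1 +
      l * z * indicator (Ioc (0 : ℝ) 1) (fun _ => (1 : ℝ)) z) (Ioi 0) ν := by
  have hmin : IntegrableOn (fun z : ℝ => min 1 (z ^ 2)) (Ioi 0) ν := by
    refine ⟨by fun_prop, ?_⟩
    rw [hasFiniteIntegral_iff_ofReal (ae_of_all _ fun z => by positivity)]
    exact hν.2.lt_top
  refine (hmin.const_mul (1 + l ^ 2)).mono' ?_ ?_
  · have : Measurable (indicator (Ioc (0 : ℝ) 1) (fun _ => (1 : ℝ))) :=
      measurable_const.indicator measurableSet_Ioc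
    exact Measurable.aestronglyMeasurable (by fun_prop)
  · filter_upwards [ae_restrict_mem measurableSet_Ioi] with z hz
    exact abs_levyIntegrand_le hl hz

/-- Strict decrease of the slopes of `1 - exp (-· * z)` from the origin. -/
lemma mul_exp_sub_one_lt {a d z : ℝ} (ha : 0 < a) (had : a < d) (hz : 0 < z) :
    d * (Real.exp (-a * z) - 1) < a * (Real.exp (-d * z) - 1) := by
  have hd : 0 < d := ha.trans had
  have h := strictConvexOn_exp.2 (mem_univ (-d * z)) (mem_univ 0)
    (by nlinarith) (show 0 < a / d by positivity)
    (show 0 < 1 - a / d by rw [sub_pos, div_lt_one hd]; exact had) (by ring)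
  simp only [smul_eq_mul, mul_zero, add_zero, Real.exp_zero, mul_one] at h
  rw [show a / d * (-d * z) = -a * z by field_simp] at h
  have h' := mul_lt_mul_of_pos_left h hd
  rw [show d * (a / d * Real.exp (-d * z) + (1 - a / d)) = a * Real.exp (-d * z) + d - a by
    field_simp; ring] at h'
  linarith

/-- The slope of the Laplace exponent from the origin is strictly increasing, unless the process is
a pure drift. -/
lemma levyPsi_slope_lt {γ σ : ℝ} {ν : Measure ℝ} (hν : IsLevyMeasure ν)
    (h : σ ≠ 0 ∨ ν (Ioi 0) ≠ 0) {a d : ℝ} (ha : 0 < a) (had : a < d) :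
    d * levyPsi γ σ ν a < a * levyPsi γ σ ν d := by
  have hd : 0 < d := ha.trans had
  have hia := integrableOn_levyIntegrand hν ha.le
  have hid := integrableOn_levyIntegrand hν hd.le
  set D : ℝ → ℝ := fun z => a * (Real.exp (-d * z) - 1 +
      d * z * indicator (Ioc (0 : ℝ) 1) (fun _ => (1 : ℝ)) z) - d * (Real.exp (-a * z) - 1 +
      a * z * indicator (Ioc (0 : ℝ) 1) (fun _ => (1 : ℝ)) z) with hD
  have hDi : IntegrableOn D (Ioi 0) ν := (hid.const_mul a).sub (hia.const_mul d)
  have hDpos : ∀ z ∈ Ioi (0 : ℝ), 0 < D z := fun z hz => by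
    have := mul_exp_sub_one_lt ha had hz
    simp only [hD]; linarith
  have hDint : ∫ z in Ioi 0, D z ∂ν = a * (levyPsi γ σ ν d - γ * d - σ ^ 2 / 2 * d ^ 2) -
      d * (levyPsi γ σ ν a - γ * a - σ ^ 2 / 2 * a ^ 2) := by
    rw [hD, integral_sub (hid.const_mul a) (hia.const_mul d), integral_const_mul,
      integral_const_mul, levyPsi, levyPsi]
    ring
  have hnn : 0 ≤ ∫ z in Ioi 0, D z ∂ν :=
    setIntegral_nonneg measurableSet_Ioi fun z hz => (hDpos z hz).le
  have hgap : 0 < a * d * (d - a) := by have := sub_pos.2 had; positivity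
  rcases h with h | h
  · have : 0 < σ ^ 2 := by positivity
    nlinarith [mul_pos this hgap]
  · have : 0 < ∫ z in Ioi 0, D z ∂ν := by
      rw [setIntegral_pos_iff_support_of_nonneg_ae
        ((ae_restrict_mem measurableSet_Ioi).mono fun z hz => (hDpos z hz).le) hDi,
        inter_eq_right.2 fun z hz => Function.mem_support.2 (hDpos z hz).ne']
      exact pos_iff_ne_zero.2 h
    nlinarith [mul_nonneg (sq_nonneg σ) hgap.le]

lemma bddAbove_levyPsi_sub_mul_eq {γ σ α q : ℝ} {ν : Measure ℝ} (hν : IsLevyMeasure ν)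
    (hα : AlphaAdmissible γ σ α ν) (hq : 0 ≤ q) :
    BddAbove {l : ℝ | 0 ≤ l ∧ levyPsi γ σ ν l - α * l = q} := by
  by_contra hb
  rw [not_bddAbove_iff] at hb
  obtain ⟨a, ⟨-, ha⟩, ha0⟩ := hb 0
  obtain ⟨d, ⟨-, hd⟩, had⟩ := hb a
  by_cases h : σ ≠ 0 ∨ ν (Ioi 0) ≠ 0
  · nlinarith [levyPsi_slope_lt (γ := γ) hν h ha0 had]
  · push Not at h
    obtain ⟨rfl, h⟩ := h
    have hr : ν.restrict (Ioi 0) = 0 := Measure.restrict_eq_zero.2 h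
    have hr1 : ν.restrict (Ioc 0 1) = 0 :=
      Measure.restrict_eq_zero.2 (measure_mono_null Ioc_subset_Ioi_self h)
    have hα2 : α < γ := by simpa [smallJumpMass, hr1] using hα.2
    simp only [levyPsi, hr, integral_zero_measure] at ha hd
    nlinarith

lemma ne_of_levyPhi_lt {γ σ α q l : ℝ} {ν : Measure ℝ} (hν : IsLevyMeasure ν)
    (hα : AlphaAdmissible γ σ α ν) (hq : 0 ≤ q)
    (hl : levyPhi (fun l => levyPsi γ σ ν l - α * l) q < l) :
    levyPsi γ σ ν l - α * l ≠ q := fun h =>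
  have h0 : 0 ≤ levyPhi (fun l => levyPsi γ σ ν l - α * l) q :=
    Real.sSup_nonneg fun _ hx => hx.1
  hl.not_ge (le_csSup (bddAbove_levyPsi_sub_mul_eq hν hα hq) ⟨h0.trans hl.le, h⟩)

/-- An integrable function on `(0, ∞)` whose Laplace transform vanishes at all natural numbers
vanishes almost everywhere. -/
lemma ae_eq_zero_of_laplace_eq_zero {g : ℝ → ℝ} (hg : IntegrableOn g (Ioi 0))
    (h : ∀ n : ℕ, ∫ y in Ioi 0, Real.exp (-(n * y)) * g y = 0) :
    ∀ᵐ y, y ∈ Ioi (0 : ℝ) → g y = 0 := by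
  have hexp : ∀ n : ℕ, IntegrableOn (fun y => Real.exp (-(n * y)) * g y) (Ioi 0) := fun n => by
    refine hg.norm.mono' ((by fun_prop : Measurable _).aestronglyMeasurable.mul hg.1) ?_
    filter_upwards [ae_restrict_mem measurableSet_Ioi] with y hy
    have hy' : 0 < y := hy
    rw [norm_mul, Real.norm_of_nonneg (Real.exp_pos _).le]
    exact mul_le_of_le_one_left (norm_nonneg _)
      (Real.exp_le_one_iff.2 (neg_nonpos.2 (by positivity)))
  have hpoly : ∀ p : Polynomial ℝ,
      IntegrableOn (fun y => p.eval (Real.exp (-y)) * g y) (Ioi 0) ∧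
        ∫ y in Ioi 0, p.eval (Real.exp (-y)) * g y = 0 := fun p => by
    have he : ∀ y, p.eval (Real.exp (-y)) * g y =
        ∑ i ∈ Finset.range (p.natDegree + 1), p.coeff i * (Real.exp (-(i * y)) * g y) := fun y => by
      rw [Polynomial.eval_eq_sum_range, Finset.sum_mul]
      refine Finset.sum_congr rfl fun i _ => ?_
      rw [← Real.exp_nat_mul, mul_neg, mul_assoc]
    simp_rw [he]
    refine ⟨integrable_finsetSum _ fun i _ => (hexp i).const_mul _, ?_⟩
    rw [integral_finsetSum _ fun i _ => (hexp i).const_mul _]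
    simp [integral_const_mul, h]
  refine isOpen_Ioi.ae_eq_zero_of_integral_contDiff_smul_eq_zero hg.locallyIntegrableOn
    fun φ hφ hφc hφs => ?_
  have hφ0 : ∀ y, y ∉ Ioi (0 : ℝ) → φ y = 0 := fun y hy =>
    image_eq_zero_of_notMem_tsupport fun h => hy (hφs h)
  rw [← setIntegral_eq_integral_of_forall_compl_eq_zero (s := Ioi 0)
    fun y hy => by simp [hφ0 y hy]]
  simp only [smul_eq_mul]
  have hψ : Continuous fun u : ℝ => φ (-Real.log u) := by
    rw [continuous_iff_continuousAt]
    intro u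
    rcases eq_or_ne u 0 with rfl | hu
    · have h1 : Tendsto (fun u : ℝ => φ (-Real.log u)) (𝓝[≠] 0) (𝓝 0) :=
        (hφc.is_zero_at_infty.mono_left atTop_le_cocompact).comp
          (tendsto_neg_atBot_atTop.comp Real.tendsto_log_nhdsNE_zero)
      rw [continuousAt_iff_punctured_nhds]
      simpa [hφ0 0 (by simp)] using h1
    · exact hφ.continuous.continuousAt.comp (Real.continuousAt_log hu).neg
  set M := ∫ y in Ioi 0, ‖g y‖
  have hM : 0 ≤ M := integral_nonneg fun _ => norm_nonneg _
  obtain ⟨C, hC⟩ := hφc.exists_bound_of_continuous hφ.continuous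
  have hφi : IntegrableOn (fun y => φ y * g y) (Ioi 0) :=
    hg.bdd_mul hφ.continuous.aestronglyMeasurable (ae_of_all _ hC)
  have key : ∀ ε > 0, |∫ y in Ioi 0, φ y * g y| ≤ ε * M := fun ε hε => by
    obtain ⟨p, hp⟩ := exists_polynomial_near_of_continuousOn 0 1 _ hψ.continuousOn ε hε
    have : ∫ y in Ioi 0, φ y * g y =
        ∫ y in Ioi 0, (φ y * g y - p.eval (Real.exp (-y)) * g y) := by
      rw [integral_sub hφi (hpoly p).1, (hpoly p).2, sub_zero]
    rw [this, ← integral_const_mul, ← Real.norm_eq_abs]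
    refine norm_integral_le_of_norm_le (hg.norm.const_mul ε) ?_
    filter_upwards [ae_restrict_mem measurableSet_Ioi] with y hy
    have := hp (Real.exp (-y)) ⟨(Real.exp_pos _).le,
      Real.exp_le_one_iff.2 (neg_nonpos.2 (le_of_lt hy))⟩
    rw [Real.log_exp, neg_neg, abs_sub_comm] at this
    rw [← sub_mul, norm_mul]
    exact mul_le_mul_of_nonneg_right this.le (norm_nonneg _)
  by_contra hne
  have hpos := abs_pos.2 hne
  have h1 := key (|∫ y in Ioi 0, φ y * g y| / (2 * (M + 1))) (by positivity)
  rw [div_mul_eq_mul_div, le_div_iff₀ (by positivity)] at h1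
  nlinarith

namespace IsScaleFunction

variable {f : ℝ → ℝ} {Φ q : ℝ} {W : ℝ → ℝ}

lemma measurable (hW : IsScaleFunction f Φ q W) : Measurable W := by
  have h : W = (Ici (0 : ℝ)).piecewise W 0 := by
    ext x
    by_cases hx : x ∈ Ici (0 : ℝ)
    · rw [piecewise_eq_of_mem _ _ _ hx]
    · rw [piecewise_eq_of_notMem _ _ _ hx]
      exact hW.1 x (not_le.1 hx)
  rw [h]
  exact hW.2.1.measurable_piecewise continuousOn_const measurableSet_Ici

lemma exists_bound (hW : IsScaleFunction f Φ q W) (R : ℝ) : ∃ C, ∀ t ≤ R, ‖W t‖ ≤ C := by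
  obtain ⟨C, hC⟩ := (isCompact_Icc (a := (0 : ℝ)) (b := R)).exists_bound_of_continuousOn
    (hW.2.1.mono Icc_subset_Ici_self)
  refine ⟨max C 0, fun t ht => ?_⟩
  rcases lt_or_ge t 0 with h | h
  · simp [hW.1 t h]
  · exact (hC t ⟨h, ht⟩).trans (le_max_left _ _)

lemma integral_exp_mul (hW : IsScaleFunction f Φ q W) {l : ℝ} (hl : Φ < l) :
    ∫ y, Real.exp (-l * y) * W y = 1 / (f l - q) := by
  rw [← hW.2.2.2 l hl]
  refine (setIntegral_eq_integral_of_ae_compl_eq_zero ?_).symm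
  filter_upwards [compl_mem_ae_iff.2 (Real.volume_singleton (a := 0))] with y hy0 hy
  rw [hW.1 y (lt_of_le_of_ne (not_lt.1 hy) hy0), mul_zero]

lemma integrable_exp_mul (hW : IsScaleFunction f Φ q W) {l : ℝ} (hl : Φ < l) (hf : f l ≠ q) :
    Integrable fun y => Real.exp (-l * y) * W y := by
  refine Integrable.of_integral_ne_zero ?_
  rw [hW.integral_exp_mul hl]
  exact one_div_ne_zero (sub_ne_zero.2 hf)

/-- The resolvent equation `q (W ∗ V) = W - V` between the `q`-scale function `W` and the
`0`-scale function `V`. -/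
lemma ae_mul_convolution_eq_sub {Φ₀ : ℝ} {V : ℝ → ℝ} (hW : IsScaleFunction f Φ q W)
    (hV : IsScaleFunction f Φ₀ 0 V) (hfq : ∀ l, Φ < l → f l ≠ q) (hf0 : ∀ l, Φ₀ < l → f l ≠ 0) :
    ∀ᵐ t, q * ∫ s, W s * V (t - s) = W t - V t := by
  set N : ℝ → ℝ := fun t => ∫ s, W s * V (t - s) with hN
  have hN0 : ∀ t < 0, N t = 0 := fun t ht => by
    have : ∀ s, W s * V (t - s) = 0 := fun s => by
      rcases lt_or_ge s 0 with h | h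
      · rw [hW.1 s h, zero_mul]
      · rw [hV.1 (t - s) (by linarith), mul_zero]
    simp [hN, this]
  have hconv : ∀ l, convolution (fun y => Real.exp (-l * y) * W y)
      (fun y => Real.exp (-l * y) * V y) (ContinuousLinearMap.mul ℝ ℝ) volume =
      fun t => Real.exp (-l * t) * N t := fun l => by
    ext t
    rw [convolution_mul, hN, ← integral_const_mul]
    congr 1 with s
    rw [show -l * t = -l * s + -l * (t - s) by ring, Real.exp_add]
    ring
  have hK : ∀ l, Φ < l → Φ₀ < l →
      Integrable (fun t => Real.exp (-l * t) * (q * N t - (W t - V t))) ∧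
        ∫ t, Real.exp (-l * t) * (q * N t - (W t - V t)) = 0 := fun l h1 h2 => by
    have iW := hW.integrable_exp_mul h1 (hfq l h1)
    have iV := hV.integrable_exp_mul h2 (hf0 l h2)
    have iN := iW.integrable_convolution (ContinuousLinearMap.mul ℝ ℝ) iV
    have eN := integral_convolution (ContinuousLinearMap.mul ℝ ℝ) iW iV
    rw [hconv] at iN eN
    rw [ContinuousLinearMap.mul_apply', hW.integral_exp_mul h1, hV.integral_exp_mul h2] at eN
    have he : (fun t => Real.exp (-l * t) * (q * N t - (W t - V t))) = fun t =>
        q * (Real.exp (-l * t) * N t) - (Real.exp (-l * t) * W t - Real.exp (-l * t) * V t) := by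
      ext t; ring
    rw [he]
    have iWV : Integrable fun t => Real.exp (-l * t) * W t - Real.exp (-l * t) * V t := iW.sub iV
    refine ⟨(iN.const_mul q).sub iWV, ?_⟩
    rw [integral_sub (iN.const_mul q) iWV, integral_sub iW iV, integral_const_mul, eN,
      hW.integral_exp_mul h1, hV.integral_exp_mul h2]
    have := sub_ne_zero.2 (hfq l h1)
    have := hf0 l h2
    field_simp
    ring
  obtain ⟨c, hc⟩ := exists_gt (max Φ Φ₀)
  obtain ⟨hc1, hc2⟩ := max_lt_iff.1 hc
  have h0 : ∀ᵐ t : ℝ, t ≠ 0 := compl_mem_ae_iff.2 (Real.volume_singleton (a := 0))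
  have hlap := ae_eq_zero_of_laplace_eq_zero (hK c hc1 hc2).1.integrableOn fun n => by
    have hn : (0 : ℝ) ≤ n := n.cast_nonneg
    have he : ∀ t, Real.exp (-(n * t)) * (Real.exp (-c * t) * (q * N t - (W t - V t))) =
        Real.exp (-(c + n) * t) * (q * N t - (W t - V t)) := fun t => by
      rw [← mul_assoc, ← Real.exp_add]
      ring_nf
    simp_rw [he]
    refine Eq.trans ?_ (hK (c + n) (by linarith) (by linarith)).2
    refine setIntegral_eq_integral_of_ae_compl_eq_zero ?_
    filter_upwards [h0] with t ht0 ht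
    have ht' := lt_of_le_of_ne (not_lt.1 ht) ht0
    simp [hN0 t ht', hW.1 t ht', hV.1 t ht']
  filter_upwards [hlap, h0] with t ht ht0
  rcases lt_or_gt_of_ne ht0 with h | h
  · rw [show ∫ s, W s * V (t - s) = 0 from hN0 t h, hW.1 t h, hV.1 t h, mul_zero, sub_zero]
  · exact sub_eq_zero.1 ((mul_eq_zero.1 (ht h)).resolve_left (Real.exp_pos _).ne')

lemma intervalIntegrable_exp_mul_comp_sub (hW : IsScaleFunction f Φ q W) (k x : ℝ) {b : ℝ}
    (hbx : b ≤ x) : IntervalIntegrable (fun y => Real.exp (k * y) * W (x - y)) volume b x := by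
  obtain ⟨C, hC⟩ := hW.exists_bound (x - b)
  rw [intervalIntegrable_iff_integrableOn_Ioc_of_le hbx]
  refine Integrable.mul_bdd (c := C) ?_
    (hW.measurable.comp (measurable_const.sub measurable_id)).aestronglyMeasurable ?_
  · exact (by fun_prop : Continuous fun y : ℝ => Real.exp (k * y)).integrableOn_Ioc
  · filter_upwards [ae_restrict_mem measurableSet_Ioc] with y hy
    exact hC _ (by linarith [hy.1])

/-- Convolving twice with scale functions amounts to convolving with their convolution. -/
lemma integral_mul_integral_exp {Φ₀ q₀ b x : ℝ} {V : ℝ → ℝ} (hW : IsScaleFunction f Φ q W)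
    (hV : IsScaleFunction f Φ₀ q₀ V) (k : ℝ) (hbx : b ≤ x) :
    IntervalIntegrable (fun y => V (x - y) * ∫ z in b..y, Real.exp (k * z) * W (y - z)) volume b x ∧
      ∫ y in b..x, V (x - y) * ∫ z in b..y, Real.exp (k * z) * W (y - z) =
        ∫ z in b..x, Real.exp (k * z) * ∫ s, W s * V (x - z - s) := by
  set F : ℝ → ℝ → ℝ := fun y z => V (x - y) * (Real.exp (k * z) * W (y - z)) with hF
  have hFi : Integrable F.uncurry ((volume.restrict (Ioc b x)).prod (volume.restrict (Ioc b x))) := by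
    obtain ⟨C, hC⟩ := hV.exists_bound (x - b)
    obtain ⟨D, hD⟩ := hW.exists_bound (x - b)
    obtain ⟨E, hE⟩ := (isCompact_Icc (a := b) (b := x)).exists_bound_of_continuousOn
      (f := fun z => Real.exp (k * z)) (by fun_prop)
    have hVm := hV.measurable
    have hWm := hW.measurable
    refine Integrable.of_bound (C := C * (E * D)) (Measurable.aestronglyMeasurable ?_) ?_
    · simp only [hF, Function.uncurry_def]
      fun_prop
    · rw [Measure.prod_restrict]
      filter_upwards [ae_restrict_mem (measurableSet_Ioc.prod measurableSet_Ioc)] with p hp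
      simp only [hF, Function.uncurry_def, norm_mul]
      have h1 := hC (x - p.1) (by linarith [hp.1.1])
      have h2 := hD (p.1 - p.2) (by linarith [hp.1.2, hp.2.1])
      have h3 := hE p.2 ⟨hp.2.1.le, hp.2.2⟩
      have hC0 := (norm_nonneg _).trans h1
      have hE0 := (norm_nonneg _).trans h3
      gcongr
  have hinner : ∀ y ∈ Icc b x, V (x - y) * ∫ z in b..y, Real.exp (k * z) * W (y - z) =
      ∫ z in Ioc b x, F y z := fun y hy => by
    rw [hF, integral_const_mul, intervalIntegral.integral_of_le hy.1]
    congr 1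
    refine (setIntegral_eq_of_subset_of_forall_sdiff_eq_zero measurableSet_Ioc
      (Ioc_subset_Ioc_right hy.2) fun z hz => ?_).symm
    have : y < z := not_le.1 fun h => hz.2 ⟨hz.1.1, h⟩
    rw [hW.1 _ (by linarith), mul_zero]
  refine ⟨?_, ?_⟩
  · rw [intervalIntegrable_iff_integrableOn_Ioc_of_le hbx]
    refine hFi.integral_prod_left.congr ?_
    filter_upwards [ae_restrict_mem measurableSet_Ioc] with y hy
    exact (hinner y ⟨hy.1.le, hy.2⟩).symm
  · rw [intervalIntegral.integral_of_le hbx, intervalIntegral.integral_of_le hbx,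
      setIntegral_congr_fun measurableSet_Ioc fun y hy => hinner y ⟨hy.1.le, hy.2⟩,
      integral_integral_swap hFi]
    refine setIntegral_congr_fun measurableSet_Ioc fun z hz => ?_
    have h1 : ∫ y in Ioc b x, F y z = ∫ y, F y z := by
      refine setIntegral_eq_integral_of_forall_compl_eq_zero fun y hy => ?_
      rcases le_or_gt y b with h | h
      · simp only [hF]
        rw [hW.1 _ (by linarith [hz.1]), mul_zero, mul_zero]
      · have : x < y := not_le.1 fun h' => hy ⟨h, h'⟩
        simp only [hF]
        rw [hV.1 _ (by linarith), zero_mul]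
    simp only [h1]
    rw [← integral_add_right_eq_self (fun y => F y z) z, ← integral_const_mul]
    congr 1 with s
    simp only [hF, add_sub_cancel_right]
    rw [show x - (s + z) = x - z - s by ring]
    ring

end IsScaleFunction

/-- For `q > 0` and all `x ≥ b`,
`∫_b^x 𝕎(x-y) ( e^{Φ(q)y} + αΦ(q)∫_b^y e^{Φ(q)z} 𝕎^{(q)}(y-z) dz ) dy
  = (1 - αΦ(q)/q) ∫_b^x e^{Φ(q)y} 𝕎(x-y) dy + (αΦ(q)/q) ∫_b^x e^{Φ(q)y} 𝕎^{(q)}(x-y) dy`. -/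
theorem exp_convolution_identity
    (γ σ : ℝ) (hσ : 0 ≤ σ) (ν : Measure ℝ) (hν : IsLevyMeasure ν)
    (hnd : NonDegenerate γ σ ν)
    (α : ℝ) (hα : AlphaAdmissible γ σ α ν)
    (b : ℝ) (hb : 0 < b) (q : ℝ) (hq : 0 < q)
    (Wαq Wα0 : ℝ → ℝ)
    (hWαq : IsScaleFunction (fun l => levyPsi γ σ ν l - α * l)
      (levyPhi (fun l => levyPsi γ σ ν l - α * l) q) q Wαq)
    (hWα0 : IsScaleFunction (fun l => levyPsi γ σ ν l - α * l)
      (levyPhi (fun l => levyPsi γ σ ν l - α * l) 0) 0 Wα0) :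
    ∀ x : ℝ, b ≤ x →
      (∫ y in b..x, Wα0 (x - y) *
          (Real.exp (levyPhi (levyPsi γ σ ν) q * y) +
            α * levyPhi (levyPsi γ σ ν) q *
              ∫ z in b..y, Real.exp (levyPhi (levyPsi γ σ ν) q * z) * Wαq (y - z))) =
        (1 - α * levyPhi (levyPsi γ σ ν) q / q) *
            (∫ y in b..x, Real.exp (levyPhi (levyPsi γ σ ν) q * y) * Wα0 (x - y)) +
          α * levyPhi (levyPsi γ σ ν) q / q *
            ∫ y in b..x, Real.exp (levyPhi (levyPsi γ σ ν) q * y) * Wαq (x - y) := by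
  intro x hx
  set Φ := levyPhi (levyPsi γ σ ν) q
  have hres := hWαq.ae_mul_convolution_eq_sub hWα0 (fun l => ne_of_levyPhi_lt hν hα hq.le)
    (fun l => ne_of_levyPhi_lt hν hα le_rfl)
  obtain ⟨hi, he⟩ := hWαq.integral_mul_integral_exp hWα0 Φ hx
  have h0 := hWα0.intervalIntegrable_exp_mul_comp_sub Φ x hx
  have hq' := hWαq.intervalIntegrable_exp_mul_comp_sub Φ x hx
  have hconv : ∫ z in b..x, Real.exp (Φ * z) * ∫ s, Wαq s * Wα0 (x - z - s) =
      ∫ z in b..x, q⁻¹ * (Real.exp (Φ * z) * Wαq (x - z) - Real.exp (Φ * z) * Wα0 (x - z)) := by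
    refine intervalIntegral.integral_congr_ae ?_
    filter_upwards [(quasiMeasurePreserving_sub_left_of_right_invariant volume x).ae hres]
      with z hz _
    rw [← mul_sub, ← hz]
    field_simp
  rw [intervalIntegral.integral_const_mul, intervalIntegral.integral_sub hq' h0] at hconv
  have hsplit : ∀ y, Wα0 (x - y) * (Real.exp (Φ * y) +
      α * Φ * ∫ z in b..y, Real.exp (Φ * z) * Wαq (y - z)) =
      Real.exp (Φ * y) * Wα0 (x - y) +
        α * Φ * (Wα0 (x - y) * ∫ z in b..y, Real.exp (Φ * z) * Wαq (y - z)) := fun y => by ring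
  simp_rw [hsplit]
  rw [intervalIntegral.integral_add h0 (hi.const_mul _), intervalIntegral.integral_const_mul, he,
    hconv]
  field_simp
  ring
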